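/- The number of parking functions of size n whose parking permutation avoids both 312 and 321 equals n! · ∑_{k=1}^n binom(n−1, k−1)/k!. -/

import Mathlib

open Finset

noncomputable section

/-- The parking process over the first `k` cars (cars are `0,...,k-1`, i.e. cars `1,...,k`
in 1-indexed terms): returns `some occ` where `occ` maps each spot to the car parked there
(`none` meaning empty), or `none` if some car failed to park.  Car `c` drives to its
preferred spot `f c` and parks at the first free spot with index `≥ f c`, failing if
no such spot exists. -/
def parkAux {n : ℕ} (f : Fin n → Fin n) : ℕ → Option (Fin n → Option (Fin n))
  | 0 => some fun _ => none
  | k + 1 =>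
    (parkAux f k).bind fun occ =>
      if h : k < n then
        if hS : (Finset.univ.filter fun s => f ⟨k, h⟩ ≤ s ∧ occ s = none).Nonempty then
          some (Function.update occ
            ((Finset.univ.filter fun s => f ⟨k, h⟩ ≤ s ∧ occ s = none).min' hS)
            (some ⟨k, h⟩))
        else none
      else some occ

/-- All `n` cars park successfully. -/
def AllPark {n : ℕ} (f : Fin n → Fin n) : Prop := (parkAux f n).isSome

/-- `f` is a parking function: for every `i ∈ [n]`, at least `i` cars prefer
the first `i` spots.  (Here `i : Fin n` denotes the `(i+1)`-st spot, 0-indexed.) -/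
def IsParkingFunction {n : ℕ} (f : Fin n → Fin n) : Prop :=
  ∀ i : Fin n, i.val + 1 ≤ (Finset.univ.filter fun j => f j ≤ i).card

/-- `ρ` is the parking permutation of `f`: after all cars have parked,
spot `i` is occupied by car `ρ i`. -/
def IsParkingPerm {n : ℕ} (f : Fin n → Fin n) (ρ : Equiv.Perm (Fin n)) : Prop :=
  parkAux f n = some fun i => some (ρ i)

/-- `π` contains `σ` as a pattern. -/
def ContainsPattern {n m : ℕ} (π : Equiv.Perm (Fin n)) (σ : Equiv.Perm (Fin m)) : Prop :=
  ∃ g : Fin m → Fin n, StrictMono g ∧ ∀ a b : Fin m, σ a < σ b ↔ π (g a) < π (g b)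

/-- `ρ` avoids every pattern in the list `pats`. -/
def AvoidsAll {n : ℕ} (ρ : Equiv.Perm (Fin n)) (pats : List (Equiv.Perm (Fin 3))) : Prop :=
  ∀ σ ∈ pats, ¬ ContainsPattern ρ σ

/-- The number of parking functions of size `n` whose parking permutation avoids
all patterns in `pats`. -/
def pk (n : ℕ) (pats : List (Equiv.Perm (Fin 3))) : ℕ :=
  Nat.card {f : Fin n → Fin n // IsParkingFunction f ∧
    ∃ ρ : Equiv.Perm (Fin n), IsParkingPerm f ρ ∧ AvoidsAll ρ pats}

def p123 : Equiv.Perm (Fin 3) := Equiv.ofBijective ![0, 1, 2] (by decide)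
def p132 : Equiv.Perm (Fin 3) := Equiv.ofBijective ![0, 2, 1] (by decide)
def p213 : Equiv.Perm (Fin 3) := Equiv.ofBijective ![1, 0, 2] (by decide)
def p231 : Equiv.Perm (Fin 3) := Equiv.ofBijective ![1, 2, 0] (by decide)
def p312 : Equiv.Perm (Fin 3) := Equiv.ofBijective ![2, 0, 1] (by decide)
def p321 : Equiv.Perm (Fin 3) := Equiv.ofBijective ![2, 1, 0] (by decide)

/-- Admissible preferences for the car parked in spot `i`. -/
def okSet {n : ℕ} (ρ : Equiv.Perm (Fin n)) (i : Fin n) : Finset (Fin n) :=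
  Finset.univ.filter fun p => p ≤ i ∧ ∀ j, p ≤ j → j ≤ i → ρ j ≤ ρ i

/-- The configuration after the first `k` cars have parked. -/
def occK {n : ℕ} (ρ : Equiv.Perm (Fin n)) (k : ℕ) : Fin n → Option (Fin n) :=
  fun s => if (ρ s).val < k then some (ρ s) else none

lemma park_backward {n : ℕ} (f : Fin n → Fin n) (ρ : Equiv.Perm (Fin n))
    (H : ∀ i, f (ρ i) ∈ okSet ρ i) (k : ℕ) (hk : k ≤ n) :
    parkAux f k = some (occK ρ k) := by
  induction k with
  | zero => simp [parkAux]; rfl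
  | succ k ih =>
    have h : k < n := hk
    have hi := H (ρ.symm ⟨k, h⟩)
    simp only [okSet, Equiv.apply_symm_apply, Finset.mem_filter, Finset.mem_univ, true_and] at hi
    have hmem : ρ.symm ⟨k, h⟩ ∈
        (Finset.univ.filter fun s => f ⟨k, h⟩ ≤ s ∧ occK ρ k s = none) := by
      simp [occK, hi.1]
    have hS : (Finset.univ.filter fun s => f ⟨k, h⟩ ≤ s ∧ occK ρ k s = none).Nonempty := ⟨_, hmem⟩
    have hmin : (Finset.univ.filter fun s => f ⟨k, h⟩ ≤ s ∧ occK ρ k s = none).min' hS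
        = ρ.symm ⟨k, h⟩ := by
      apply le_antisymm (Finset.min'_le _ _ hmem)
      apply Finset.le_min'
      intro j hj
      replace hj := (Finset.mem_filter.1 hj).2
      by_contra hlt
      push Not at hlt
      have h1 := hi.2 j hj.1 hlt.le
      have h2 : ¬ (ρ j).val < k := by
        intro h3; simp [occK] at hj; omega
      have h3 : ρ j = ⟨k, h⟩ := by
        apply le_antisymm h1
        show k ≤ (ρ j).val
        omega
      have : j = ρ.symm ⟨k, h⟩ := by rw [← h3]; simp
      exact absurd hlt (by rw [← this]; exact lt_irrefl _)
    simp only [parkAux, ih h.le, Option.bind_some, dif_pos h, dif_pos hS, hmin]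
    congr 1
    funext s
    by_cases hs : s = ρ.symm ⟨k, h⟩
    · subst hs; simp [occK]
    · rw [Function.update_of_ne hs]
      have : (ρ s).val ≠ k := by
        intro h4; apply hs; rw [Equiv.eq_symm_apply]; exact Fin.ext h4
      simp only [occK]
      by_cases h5 : (ρ s).val < k
      · rw [if_pos h5, if_pos (by omega)]
      · rw [if_neg h5, if_neg (by omega)]

lemma park_step {n : ℕ} (f : Fin n → Fin n) (ρ : Equiv.Perm (Fin n)) (k : ℕ) (h : k < n)
    (H : parkAux f (k+1) = some (occK ρ (k+1))) :
    parkAux f k = some (occK ρ k) ∧ f ⟨k, h⟩ ∈ okSet ρ (ρ.symm ⟨k, h⟩) := by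
  rw [parkAux] at H
  rcases hp : parkAux f k with _ | occ
  · simp [hp] at H
  simp only [hp, Option.bind_some, dif_pos h] at H
  split_ifs at H with hS
  have hm := Finset.min'_mem _ hS
  have hle : ∀ t, t ∈ (Finset.univ.filter fun s => f ⟨k, h⟩ ≤ s ∧ occ s = none) →
      (Finset.univ.filter fun s => f ⟨k, h⟩ ≤ s ∧ occ s = none).min' hS ≤ t :=
    fun t ht => Finset.min'_le _ t ht
  generalize (Finset.univ.filter fun s => f ⟨k, h⟩ ≤ s ∧ occ s = none).min' hS = s at *
  have H' : Function.update occ s (some ⟨k, h⟩) = occK ρ (k+1) := Option.some.inj H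
  simp only [Finset.mem_filter, Finset.mem_univ, true_and] at hm hle
  have hs : ρ s = ⟨k, h⟩ := by
    have := congrFun H' s
    simp only [Function.update_self, occK] at this
    split_ifs at this with h1
    exact (Option.some.inj this).symm
  have hs' : ρ.symm ⟨k, h⟩ = s := by rw [← hs]; simp
  have hocc : occ = occK ρ k := by
    funext t
    by_cases ht : t = s
    · subst ht; simp [hm.2, occK, hs]
    · have := congrFun H' t
      rw [Function.update_of_ne ht] at this
      rw [this]
      have : (ρ t).val ≠ k := by
        intro h4; apply ht; apply ρ.injective; rw [hs]; exact Fin.ext h4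
      simp only [occK]
      by_cases h5 : (ρ t).val < k
      · rw [if_pos h5, if_pos (by omega)]
      · rw [if_neg h5, if_neg (by omega)]
  refine ⟨by rw [hocc], ?_⟩
  rw [hs']
  simp only [okSet, Finset.mem_filter, Finset.mem_univ, true_and]
  refine ⟨hm.1, fun j hj1 hj2 => ?_⟩
  by_contra hc
  have h6 : ¬ (ρ j).val < k := by
    intro h7; apply hc; rw [hs]; exact h7.le
  have := hle j ⟨hj1, by rw [hocc]; simp [occK]; omega⟩
  exact hc (by rw [le_antisymm hj2 this])

lemma isParkingPerm_iff {n : ℕ} (f : Fin n → Fin n) (ρ : Equiv.Perm (Fin n)) :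
    IsParkingPerm f ρ ↔ ∀ i, f (ρ i) ∈ okSet ρ i := by
  have hocc : (fun i => some (ρ i)) = occK ρ n := by
    funext i; simp [occK]
  unfold IsParkingPerm
  rw [hocc]
  constructor
  · intro H
    have key : ∀ d k, k + d = n → parkAux f k = some (occK ρ k) := by
      intro d
      induction d with
      | zero => intro k hk; obtain rfl : k = n := hk; exact H
      | succ d ih => intro k hk; exact (park_step f ρ k (by omega) (ih (k+1) (by omega))).1
    intro i
    have := (park_step f ρ (ρ i).val (ρ i).isLt (key (n - (ρ i).val - 1) _ (by omega))).2
    simpa using this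
  · intro H; exact park_backward f ρ H n le_rfl

lemma isParkingFunction_of {n : ℕ} (f : Fin n → Fin n) (ρ : Equiv.Perm (Fin n))
    (H : ∀ i, f (ρ i) ∈ okSet ρ i) : IsParkingFunction f := by
  intro i
  have : (Finset.Iic i).image ρ ⊆ Finset.univ.filter fun j => f j ≤ i := by
    intro c hc
    obtain ⟨s, hs, rfl⟩ := Finset.mem_image.1 hc
    have := H s
    simp only [okSet, Finset.mem_filter, Finset.mem_univ, true_and, Finset.mem_Iic] at *
    exact this.1.trans hs
  have h2 := Finset.card_le_card this
  rwa [Finset.card_image_of_injective _ ρ.injective, Fin.card_Iic] at h2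

/-- No entry has two smaller entries to its right. -/
def Good {n : ℕ} (ρ : Equiv.Perm (Fin n)) : Prop :=
  ∀ i j k, i < j → j < k → ρ j < ρ i → ρ k < ρ i → False

lemma avoids_iff {n : ℕ} (ρ : Equiv.Perm (Fin n)) : AvoidsAll ρ [p312, p321] ↔ Good ρ := by
  have mono : ∀ i j k : Fin n, i < j → j < k → StrictMono ![i, j, k] := by
    intro i j k h1 h2
    rw [Fin.strictMono_iff_lt_succ]
    intro a
    fin_cases a
    · exact h1
    · exact h2
  constructor
  · intro H i j k hij hjk h1 h2
    rcases lt_trichotomy (ρ j) (ρ k) with h | h | h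
    · refine H p312 (by simp) ⟨![i, j, k], mono i j k hij hjk, ?_⟩
      intro a b
      fin_cases a <;> fin_cases b <;> simp [p312, h1, h2, h, h1.le, h2.le, h.le]
    · exact hjk.ne (ρ.injective h)
    · refine H p321 (by simp) ⟨![i, j, k], mono i j k hij hjk, ?_⟩
      intro a b
      fin_cases a <;> fin_cases b <;> simp [p321, h1, h2, h, h1.le, h2.le, h.le]
  · intro H σ hσ
    rintro ⟨g, hg, hp⟩
    have key : σ 1 < σ 0 ∧ σ 2 < σ 0 := by
      simp only [List.mem_cons, List.not_mem_nil, or_false] at hσ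
      rcases hσ with rfl | rfl <;> simp [p312, p321]
    exact H (g 0) (g 1) (g 2) (hg (by decide)) (hg (by decide)) ((hp _ _).1 key.1) ((hp _ _).1 key.2)

/-- Number of parking functions with parking permutation `ρ`. -/
def wt {n : ℕ} (ρ : Equiv.Perm (Fin n)) : ℕ := ∏ i, (okSet ρ i).card

open Classical in
/-- The good permutations. -/
def goods (n : ℕ) : Finset (Equiv.Perm (Fin n)) := Finset.univ.filter Good

lemma mem_goods {n : ℕ} (ρ : Equiv.Perm (Fin n)) : ρ ∈ goods n ↔ Good ρ := by simp [goods]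

lemma pk_eq (n : ℕ) : pk n [p312, p321] = ∑ ρ ∈ goods n, wt ρ := by
  classical
  have hcard : ∀ ρ : Equiv.Perm (Fin n),
      (Fintype.piFinset fun c => okSet ρ (ρ.symm c)).card = wt ρ := by
    intro ρ
    rw [Fintype.card_piFinset, wt]
    exact Equiv.prod_comp ρ.symm (fun i => (okSet ρ i).card)
  have hmem : ∀ (ρ : Equiv.Perm (Fin n)) f,
      f ∈ (Fintype.piFinset fun c => okSet ρ (ρ.symm c)) ↔ IsParkingPerm f ρ := by
    intro ρ f
    rw [Fintype.mem_piFinset, isParkingPerm_iff]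
    constructor
    · intro H i; simpa using H (ρ i)
    · intro H c; simpa using H (ρ.symm c)
  rw [pk, Nat.card_eq_fintype_card, Fintype.card_subtype]
  simp_rw [← hcard]
  rw [← Finset.card_biUnion]
  · congr 1
    ext f
    simp only [Finset.mem_filter, Finset.mem_univ, true_and, Finset.mem_biUnion, hmem, mem_goods,
      avoids_iff]
    constructor
    · rintro ⟨-, ρ, h1, h2⟩; exact ⟨ρ, h2, h1⟩
    · rintro ⟨ρ, h2, h1⟩
      exact ⟨isParkingFunction_of f ρ ((isParkingPerm_iff f ρ).1 h1), ρ, h1, h2⟩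
  · intro ρ _ τ _ hne
    simp only [Function.onFun]
    rw [Finset.disjoint_left]
    intro f h1 h2
    rw [hmem] at h1 h2
    apply hne
    unfold IsParkingPerm at h1 h2
    rw [h1] at h2
    have := Option.some.inj h2
    ext i
    have := Option.some.inj (congrFun this i)
    rw [this]

/-- Append a new maximum at the end. -/
def extE {n : ℕ} (ρ : Equiv.Perm (Fin n)) : Equiv.Perm (Fin (n+1)) where
  toFun := Fin.lastCases (Fin.last n) (fun i => (ρ i).castSucc)
  invFun := Fin.lastCases (Fin.last n) (fun i => (ρ.symm i).castSucc)
  left_inv := by intro i; refine Fin.lastCases ?_ (fun i => ?_) i <;> simp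
  right_inv := by intro i; refine Fin.lastCases ?_ (fun i => ?_) i <;> simp

@[simp] lemma extE_last {n : ℕ} (ρ : Equiv.Perm (Fin n)) : extE ρ (Fin.last n) = Fin.last n := by
  simp [extE]

@[simp] lemma extE_castSucc {n : ℕ} (ρ : Equiv.Perm (Fin n)) (i : Fin n) :
    extE ρ i.castSucc = (ρ i).castSucc := by
  simp [extE]

lemma extE_inj {n : ℕ} : Function.Injective (extE (n := n)) := by
  intro ρ τ h
  ext i
  have := congrArg (fun σ => (σ i.castSucc).val) h
  simpa using this

lemma exists_extE {n : ℕ} (σ : Equiv.Perm (Fin (n+1))) (h : σ (Fin.last n) = Fin.last n) :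
    ∃ ρ, σ = extE ρ := by
  have h1 : ∀ i : Fin n, ∃ j : Fin n, σ i.castSucc = j.castSucc := by
    intro i
    have : σ i.castSucc ≠ Fin.last n := by
      intro h2
      rw [← h] at h2
      exact (Fin.castSucc_lt_last i).ne (σ.injective h2)
    obtain ⟨j, hj⟩ := Fin.exists_castSucc_eq.2 this
    exact ⟨j, hj.symm⟩
  choose g hg using h1
  have ginj : Function.Injective g := by
    intro a b hab
    have : σ a.castSucc = σ b.castSucc := by rw [hg, hg, hab]
    exact Fin.castSucc_injective _ (σ.injective this)
  refine ⟨Equiv.ofBijective g (Finite.injective_iff_bijective.1 ginj), ?_⟩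
  apply Equiv.ext
  intro i
  refine Fin.lastCases ?_ (fun i => ?_) i
  · simp [h]
  · simp [hg]

/-- Insert a new maximum just before the last entry. -/
def extB {m : ℕ} (ρ : Equiv.Perm (Fin (m+1))) : Equiv.Perm (Fin (m+2)) :=
  Equiv.swap (Fin.last (m+1)) (Fin.last m).castSucc |>.trans (extE ρ)

@[simp] lemma extB_last {m : ℕ} (ρ : Equiv.Perm (Fin (m+1))) :
    extB ρ (Fin.last (m+1)) = (ρ (Fin.last m)).castSucc := by
  simp [extB]

@[simp] lemma extB_castSucc_last {m : ℕ} (ρ : Equiv.Perm (Fin (m+1))) :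
    extB ρ (Fin.last m).castSucc = Fin.last (m+1) := by
  simp [extB]

@[simp] lemma extB_castSucc_castSucc {m : ℕ} (ρ : Equiv.Perm (Fin (m+1))) (i : Fin m) :
    extB ρ i.castSucc.castSucc = (ρ i.castSucc).castSucc := by
  have h1 : i.castSucc.castSucc ≠ Fin.last (m+1) := (Fin.castSucc_lt_last _).ne
  have h2 : i.castSucc.castSucc ≠ (Fin.last m).castSucc := by
    intro h; exact (Fin.castSucc_lt_last i).ne (Fin.castSucc_injective _ h)
  simp [extB, Equiv.swap_apply_of_ne_of_ne h1 h2]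

lemma extB_inj {m : ℕ} : Function.Injective (extB (m := m)) := by
  intro ρ τ h
  apply extE_inj
  apply Equiv.ext
  intro x
  have := congrArg (fun σ => σ (Equiv.swap (Fin.last (m+1)) (Fin.last m).castSucc x)) h
  simpa [extB] using this

lemma exists_extB {m : ℕ} (σ : Equiv.Perm (Fin (m+2)))
    (h : σ (Fin.last m).castSucc = Fin.last (m+1)) : ∃ ρ, σ = extB ρ := by
  obtain ⟨ρ, hρ⟩ := exists_extE
    ((Equiv.swap (Fin.last (m+1)) (Fin.last m).castSucc).trans σ) (by simp [h])
  refine ⟨ρ, ?_⟩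
  rw [extB, ← hρ]
  apply Equiv.ext
  intro x
  simp

lemma good_extE {n : ℕ} (ρ : Equiv.Perm (Fin n)) : Good (extE ρ) ↔ Good ρ := by
  constructor
  · intro H i j k h1 h2 h3 h4
    exact H i.castSucc j.castSucc k.castSucc (by simpa using h1) (by simpa using h2)
      (by simpa using h3) (by simpa using h4)
  · intro H i j k
    refine Fin.lastCases ?_ (fun k => ?_) k
    · intro _ _ _ h4
      rw [extE_last] at h4
      exact absurd h4 (Fin.le_last _).not_gt
    · refine Fin.lastCases ?_ (fun j => ?_) j
      · intro _ h; exact absurd h (Fin.le_last _).not_gt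
      · refine Fin.lastCases ?_ (fun i => ?_) i
        · intro h; exact absurd h (Fin.le_last _).not_gt
        · simpa using H i j k

lemma good_extB {m : ℕ} (ρ : Equiv.Perm (Fin (m+1))) : Good (extB ρ) ↔ Good ρ := by
  constructor
  · intro H i j k h1 h2 h3 h4
    have hj : j ≠ Fin.last m := (h2.trans_le (Fin.le_last _)).ne
    have hi : i ≠ Fin.last m := (h1.trans_le (Fin.le_last _)).ne
    obtain ⟨i, rfl⟩ := Fin.exists_castSucc_eq.2 hi
    obtain ⟨j, rfl⟩ := Fin.exists_castSucc_eq.2 hj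
    by_cases hk : k = Fin.last m
    · subst hk
      exact H i.castSucc.castSucc j.castSucc.castSucc (Fin.last _) (by simpa using h1)
        (Fin.castSucc_lt_last _) (by simpa using h3) (by simpa using h4)
    · obtain ⟨k, rfl⟩ := Fin.exists_castSucc_eq.2 hk
      exact H i.castSucc.castSucc j.castSucc.castSucc k.castSucc.castSucc (by simpa using h1)
        (by simpa using h2) (by simpa using h3) (by simpa using h4)
  · intro H i j k h1 h2 h3 h4
    have hj : j ≠ Fin.last (m+1) := (h2.trans_le (Fin.le_last _)).ne
    obtain ⟨j, rfl⟩ := Fin.exists_castSucc_eq.2 hj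
    have hj' : j ≠ Fin.last m := by
      rintro rfl
      rw [extB_castSucc_last] at h3
      exact absurd h3 (Fin.le_last _).not_gt
    obtain ⟨j, rfl⟩ := Fin.exists_castSucc_eq.2 hj'
    have hi : i ≠ Fin.last (m+1) := (h1.trans_le (Fin.le_last _)).ne
    obtain ⟨i, rfl⟩ := Fin.exists_castSucc_eq.2 hi
    have h1' : i < j.castSucc := by simpa using h1
    have hi' : i ≠ Fin.last m := (h1'.trans_le (Fin.le_last _)).ne
    obtain ⟨i, rfl⟩ := Fin.exists_castSucc_eq.2 hi'
    by_cases hk : k = Fin.last (m+1)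
    · subst hk
      exact H i.castSucc j.castSucc (Fin.last m) h1' (Fin.castSucc_lt_last _) (by simpa using h3)
        (by simpa using h4)
    · obtain ⟨k, rfl⟩ := Fin.exists_castSucc_eq.2 hk
      by_cases hk' : k = Fin.last m
      · subst hk'
        rw [extB_castSucc_last] at h4
        exact absurd h4 (Fin.le_last _).not_gt
      · obtain ⟨k, rfl⟩ := Fin.exists_castSucc_eq.2 hk'
        exact H i.castSucc j.castSucc k.castSucc h1' (by simpa using h2) (by simpa using h3)
          (by simpa using h4)

lemma good_cases {m : ℕ} (σ : Equiv.Perm (Fin (m+2))) (H : Good σ) :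
    σ (Fin.last _) = Fin.last _ ∨ σ (Fin.last m).castSucc = Fin.last (m+1) := by
  by_contra hc
  push Not at hc
  obtain ⟨i, hi⟩ := σ.surjective (Fin.last (m+1))
  have h1 : i ≠ Fin.last _ := by rintro rfl; exact hc.1 hi
  obtain ⟨i, rfl⟩ := Fin.exists_castSucc_eq.2 h1
  have h2 : i ≠ Fin.last _ := by rintro rfl; exact hc.2 hi
  refine H i.castSucc (Fin.last m).castSucc (Fin.last _) ?_ (Fin.castSucc_lt_last _) ?_ ?_
  · simpa using Fin.lt_last_iff_ne_last.2 h2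
  · rw [hi]; exact Fin.lt_last_iff_ne_last.2 hc.2
  · rw [hi]; exact Fin.lt_last_iff_ne_last.2 hc.1

lemma sum_goods {m : ℕ} (F : Equiv.Perm (Fin (m+2)) → ℕ) :
    ∑ σ ∈ goods (m+2), F σ =
      ∑ ρ ∈ goods (m+1), F (extE ρ) + ∑ ρ ∈ goods (m+1), F (extB ρ) := by
  classical
  have : goods (m+2) = (goods (m+1)).image extE ∪ (goods (m+1)).image extB := by
    ext σ
    simp only [mem_goods, Finset.mem_union, Finset.mem_image]
    constructor
    · intro H
      rcases good_cases σ H with h | h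
      · obtain ⟨ρ, rfl⟩ := exists_extE σ h
        exact Or.inl ⟨ρ, (good_extE ρ).1 H, rfl⟩
      · obtain ⟨ρ, rfl⟩ := exists_extB σ h
        exact Or.inr ⟨ρ, (good_extB ρ).1 H, rfl⟩
    · rintro (⟨ρ, h, rfl⟩ | ⟨ρ, h, rfl⟩)
      · exact (good_extE ρ).2 h
      · exact (good_extB ρ).2 h
  rw [this, Finset.sum_union, Finset.sum_image extE_inj.injOn, Finset.sum_image extB_inj.injOn]
  rw [Finset.disjoint_left]
  intro σ h1 h2
  obtain ⟨ρ, _, rfl⟩ := Finset.mem_image.1 h1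
  obtain ⟨τ, _, h⟩ := Finset.mem_image.1 h2
  have := congrArg (fun σ => σ (Fin.last (m+1))) h
  simp only [extB_last, extE_last] at this
  exact (Fin.castSucc_lt_last _).ne this

lemma okSet_castSucc {n : ℕ} (σ : Equiv.Perm (Fin (n+1))) (ρ : Equiv.Perm (Fin n)) (i : Fin n)
    (h : ∀ j ≤ i, σ j.castSucc = (ρ j).castSucc) :
    (okSet σ i.castSucc).card = (okSet ρ i).card := by
  rw [← Finset.card_map (s := okSet ρ i) Fin.castSuccEmb]
  congr 1
  ext p
  simp only [okSet, Finset.mem_filter, Finset.mem_univ, true_and, Finset.mem_map,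
    Fin.coe_castSuccEmb]
  constructor
  · rintro ⟨h1, h2⟩
    have hp : p ≠ Fin.last _ := (h1.trans_lt (Fin.castSucc_lt_last _)).ne
    obtain ⟨p, rfl⟩ := Fin.exists_castSucc_eq.2 hp
    refine ⟨p, ⟨by simpa using h1, fun j hj1 hj2 => ?_⟩, rfl⟩
    have := h2 j.castSucc (by simpa using hj1) (by simpa using hj2)
    rw [h j hj2, h i le_rfl] at this
    simpa using this
  · rintro ⟨p, ⟨h1, h2⟩, rfl⟩
    refine ⟨by simpa using h1, fun j hj1 hj2 => ?_⟩
    have hj : j ≠ Fin.last _ := (hj2.trans_lt (Fin.castSucc_lt_last _)).ne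
    obtain ⟨j, rfl⟩ := Fin.exists_castSucc_eq.2 hj
    have hj2' : j ≤ i := by simpa using hj2
    rw [h j hj2', h i le_rfl]
    simpa using h2 j (by simpa using hj1) hj2'

lemma okSet_max {n : ℕ} (σ : Equiv.Perm (Fin (n+1))) (i : Fin (n+1)) (h : σ i = Fin.last n) :
    (okSet σ i).card = i.val + 1 := by
  have : okSet σ i = Finset.Iic i := by
    ext p
    simp [okSet, h, Fin.le_last]
  rw [this, Fin.card_Iic]

lemma okSet_extB_last {m : ℕ} (ρ : Equiv.Perm (Fin (m+1))) :
    (okSet (extB ρ) (Fin.last (m+1))).card = 1 := by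
  rw [Finset.card_eq_one]
  refine ⟨Fin.last _, ?_⟩
  ext p
  simp only [okSet, Finset.mem_filter, Finset.mem_univ, true_and, Finset.mem_singleton]
  constructor
  · rintro ⟨-, h⟩
    by_contra hp
    obtain ⟨p, rfl⟩ := Fin.exists_castSucc_eq.2 hp
    have := h (Fin.last m).castSucc (by simpa using Fin.le_last p) (Fin.le_last _)
    rw [extB_castSucc_last, extB_last] at this
    exact absurd this (Fin.castSucc_lt_last _).not_ge
  · rintro rfl
    refine ⟨le_rfl, fun j h1 h2 => ?_⟩
    rw [le_antisymm h2 h1]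

/-- The weight with the last factor removed. -/
def vt {m : ℕ} (ρ : Equiv.Perm (Fin (m+1))) : ℕ := ∏ i : Fin m, (okSet ρ i.castSucc).card

lemma vt_extE {m : ℕ} (ρ : Equiv.Perm (Fin (m+1))) : vt (extE ρ) = wt ρ := by
  unfold vt wt
  exact Finset.prod_congr rfl fun i _ => okSet_castSucc _ _ _ fun j _ => extE_castSucc ρ j

lemma wt_extE {m : ℕ} (ρ : Equiv.Perm (Fin (m+1))) : wt (extE ρ) = wt ρ * (m + 2) := by
  rw [wt, Fin.prod_univ_castSucc, ← vt_extE, vt, okSet_max _ _ (extE_last ρ)]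
  simp

lemma vt_extB {m : ℕ} (ρ : Equiv.Perm (Fin (m+1))) : vt (extB ρ) = vt ρ * (m + 1) := by
  rw [vt, Fin.prod_univ_castSucc, okSet_max _ _ (extB_castSucc_last ρ), vt]
  congr 1
  refine Finset.prod_congr rfl fun i _ => okSet_castSucc _ _ _ fun j hj => ?_
  have hj' : j ≠ Fin.last _ := (hj.trans_lt (Fin.castSucc_lt_last _)).ne
  obtain ⟨j, rfl⟩ := Fin.exists_castSucc_eq.2 hj'
  simp

lemma wt_extB {m : ℕ} (ρ : Equiv.Perm (Fin (m+1))) : wt (extB ρ) = vt ρ * (m + 1) := by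
  rw [wt, Fin.prod_univ_castSucc, okSet_extB_last, mul_one, ← vt_extB, vt]

lemma recW (m : ℕ) : ∑ σ ∈ goods (m+2), wt σ =
    (∑ ρ ∈ goods (m+1), wt ρ) * (m+2) + (∑ ρ ∈ goods (m+1), vt ρ) * (m+1) := by
  rw [sum_goods]; simp_rw [wt_extE, wt_extB]; rw [Finset.sum_mul, Finset.sum_mul]

lemma recV (m : ℕ) : ∑ σ ∈ goods (m+2), vt σ =
    (∑ ρ ∈ goods (m+1), wt ρ) + (∑ ρ ∈ goods (m+1), vt ρ) * (m+1) := by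
  rw [sum_goods]; simp_rw [vt_extE, vt_extB]; rw [Finset.sum_mul]

lemma goods_one : goods (0 + 1) = {1} := by
  have i1 : Subsingleton (Fin (0 + 1)) := inferInstanceAs (Subsingleton (Fin 1))
  apply Finset.ext
  intro σ
  rw [mem_goods, Finset.mem_singleton]
  constructor
  · intro _; exact Subsingleton.elim _ _
  · intro _ i j k h; exact absurd h (by rw [Subsingleton.elim i j]; exact lt_irrefl _)

/-- Normalised weights. -/
def aP (m : ℕ) : ℚ := ∑ j ∈ Finset.range (m+1), (m.choose j : ℚ) / ((j+1).factorial : ℚ)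

/-- Normalised truncated weights. -/
def aQ (m : ℕ) : ℚ := ∑ j ∈ Finset.range (m+1), (m.choose j : ℚ) / (j.factorial : ℚ)

lemma pascal_sum (m : ℕ) (g : ℕ → ℚ) :
    ∑ j ∈ Finset.range (m+2), ((m+1).choose j : ℚ) * g j =
      ∑ j ∈ Finset.range (m+1), (m.choose j : ℚ) * g j +
      ∑ j ∈ Finset.range (m+1), (m.choose j : ℚ) * g (j+1) := by
  rw [Finset.sum_range_succ']
  have h : ∑ j ∈ Finset.range (m+1), (m.choose j : ℚ) * g j =
      ∑ j ∈ Finset.range (m+1), (m.choose (j+1) : ℚ) * g (j+1) + g 0 := by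
    have h1 := Finset.sum_range_succ' (fun j => (m.choose j : ℚ) * g j) (m+1)
    rw [Finset.sum_range_succ] at h1
    simpa using h1
  rw [h]
  simp only [Nat.choose_succ_succ, Nat.cast_add, add_mul, Finset.sum_add_distrib,
    Nat.choose_zero_right, Nat.cast_one, one_mul]
  ring

lemma tele (m N : ℕ) :
    ((m:ℚ) + 2) * ∑ j ∈ Finset.range N, (m.choose j : ℚ) / ((j+2).factorial : ℚ) =
      ∑ j ∈ Finset.range N, (m.choose j : ℚ) / (j.factorial : ℚ)
        + (m.choose N : ℚ) / (N.factorial : ℚ) - (m.choose N : ℚ) / ((N+1).factorial : ℚ) := by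
  induction N with
  | zero => simp
  | succ N ih =>
    rw [Finset.sum_range_succ, mul_add, ih, Finset.sum_range_succ]
    have h : (m.choose (N+1) : ℚ) * (N+1) = m.choose N * (m - N) := by
      rcases le_or_gt N m with hN | hN
      · have := Nat.choose_succ_right_eq m N
        have h2 : ((m.choose (N+1) * (N+1) : ℕ) : ℚ) = ((m.choose N * (m - N) : ℕ) : ℚ) := by
          rw [this]
        push_cast [Nat.cast_sub hN] at h2
        exact h2
      · rw [Nat.choose_eq_zero_of_lt hN, Nat.choose_eq_zero_of_lt (by omega)]; simp
    have hf : (N.factorial : ℚ) ≠ 0 := by exact_mod_cast N.factorial_ne_zero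
    have h1 : (N:ℚ) + 1 ≠ 0 := by positivity
    have h2 : (N:ℚ) + 1 + 1 ≠ 0 := by positivity
    have h2 : (N:ℚ) + 2 ≠ 0 := by positivity
    have hc : (m.choose (N+1) : ℚ) = m.choose N * (m - N) / (N+1) := by
      rw [eq_div_iff h1, h]
    rw [hc]
    simp only [Nat.factorial_succ]
    push_cast
    field_simp
    ring

lemma aQ_succ (m : ℕ) : aQ (m+1) = aP m + aQ m := by
  unfold aQ aP
  have := pascal_sum m (fun j => 1 / (j.factorial : ℚ))
  simp only [mul_one_div] at this
  rw [this]; ring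

lemma aP_succ (m : ℕ) : ((m:ℚ)+2) * aP (m+1) = (m+2) * aP m + aQ m := by
  unfold aQ aP
  have h := pascal_sum m (fun j => 1 / ((j+1).factorial : ℚ))
  simp only [mul_one_div] at h
  have ht := tele m (m+1)
  rw [Nat.choose_succ_self] at ht
  simp only [Nat.cast_zero, zero_div, add_zero, sub_zero] at ht
  rw [h, mul_add, ht]

lemma closed (m : ℕ) :
    ((∑ ρ ∈ goods (m+1), wt ρ : ℕ) : ℚ) = (m+1).factorial * aP m ∧
    ((∑ ρ ∈ goods (m+1), vt ρ : ℕ) : ℚ) = m.factorial * aQ m := by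
  induction m with
  | zero =>
    rw [goods_one, Finset.sum_singleton, Finset.sum_singleton]
    have : (okSet (1 : Equiv.Perm (Fin 1)) 0).card = 1 := okSet_max _ 0 rfl
    simp [wt, vt, aP, aQ, this]
  | succ m ih =>
    obtain ⟨h1, h2⟩ := ih
    rw [recW, recV]
    rw [Nat.cast_add, Nat.cast_mul, Nat.cast_add (_ : ℕ) (_ * _), Nat.cast_mul _ (m+1), h1, h2,
      aQ_succ]
    have := aP_succ m
    simp only [Nat.factorial_succ]
    push_cast
    constructor
    · linear_combination (-(m+1) * (m.factorial : ℚ)) * this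
    · ring

theorem stmt19 (n : ℕ) (hn : 1 ≤ n) :
    (pk n [p312, p321] : ℚ) =
      (n.factorial : ℚ) *
        ∑ k ∈ Finset.Icc 1 n, (Nat.choose (n - 1) (k - 1) : ℚ) / (k.factorial : ℚ) := by
  obtain ⟨m, rfl⟩ : ∃ m, n = m + 1 := ⟨n - 1, by omega⟩
  rw [pk_eq, (closed m).1, aP]
  congr 1
  rw [← Finset.Ico_add_one_right_eq_Icc, Finset.sum_Ico_eq_sum_range]
  apply Finset.sum_congr (by simp)
  intro j _
  rw [Nat.add_sub_cancel_left, Nat.add_sub_cancel, Nat.add_comm 1 j]
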